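/- arXiv:1606.04059 — 2 statements merged into one kernel-verified Lean document; each statement's English description precedes it below -/
import Mathlib

section
/- Let L₃ = {(a²b)ᵐ·(ab²)ⁿ·(a²b)² : m ≥ 3, n ≥ 1} over the alphabet {a, b}. Every word w ∈ L₃ has a unique occurrence of the factor b²a² = b·b·a·a: if w = p·(b·b·a·a)·q and w = p'·(b·b·a·a)·q' for (possibly empty) words p, q, p', q', then p = p' (and hence q = q'). -/
/-- The two-letter alphabet `{a, b}`. -/
inductive AB : Type
  | a : AB
  | b : AB

/-- Words over `{a, b}`, as elements of the free monoid (the empty word is `1`). -/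
abbrev Word : Type := FreeMonoid AB

/-- The letter `a` as a word. -/
def wa : Word := FreeMonoid.of AB.a

/-- The letter `b` as a word. -/
def wb : Word := FreeMonoid.of AB.b

/-- Syntactic equivalence of `u` and `v` with respect to the language `L`:
for all (possibly empty) words `p, q`, `p·u·q ∈ L ↔ p·v·q ∈ L`. -/
def SynEq (L : Set Word) (u v : Word) : Prop :=
  ∀ p q : Word, p * u * q ∈ L ↔ p * v * q ∈ L

/-- The language `L₃ = (a²b)²(a²b)⁺(ab²)⁺(a²b)² = {(a²b)ᵐ·(ab²)ⁿ·(a²b)² : m ≥ 3, n ≥ 1}`. -/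
def L3 : Set Word :=
  {w | ∃ m n : ℕ, 3 ≤ m ∧ 1 ≤ n ∧
    w = (wa ^ 2 * wb) ^ m * (wa * wb ^ 2) ^ n * (wa ^ 2 * wb) ^ 2}

open AB in
/-- The list `(ab²)ⁿ⁺¹(a²b)²`. -/
def fList : ℕ → List AB
  | 0 => [a, b, b, a, a, b, a, a, b]
  | n + 1 => a :: b :: b :: fList n

open AB in
/-- The list `(a²b)ᵐ(ab²)ⁿ⁺¹(a²b)²`. -/
def gList (n : ℕ) : ℕ → List AB
  | 0 => fList n
  | m + 1 => a :: a :: b :: gList n m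

theorem fList_head (n : ℕ) : ∃ t, fList n = AB.a :: AB.b :: t := by
  cases n <;> exact ⟨_, rfl⟩

theorem gList_head (n m : ℕ) : ∃ t, gList n m = AB.a :: t := by
  cases m
  · obtain ⟨t, ht⟩ := fList_head n
    exact ⟨_, ht⟩
  · exact ⟨_, rfl⟩

theorem fList_occ (n : ℕ) : ∀ p q : List AB,
    fList n = p ++ AB.b :: AB.b :: AB.a :: AB.a :: q → q = [AB.b, AB.a, AB.a, AB.b] := by
  induction n with
  | zero =>
    intro p q h
    rcases p with _ | ⟨x1, _ | ⟨x2, _ | ⟨x3, _ | ⟨x4, _ | ⟨x5, _ | ⟨x6, p⟩⟩⟩⟩⟩⟩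
    all_goals simp [fList] at h
    · exact h.2.symm
    · have := congrArg List.length h.2.2.2.2.2.2
      simp at this
      omega
  | succ n ih =>
    intro p q h
    obtain ⟨t, ht⟩ := fList_head n
    rcases p with _ | ⟨x1, _ | ⟨x2, _ | ⟨x3, p⟩⟩⟩
    · simp [fList] at h
    · simp [fList, ht] at h
    · simp [fList, ht] at h
    · simp only [fList, List.cons_append, List.cons.injEq] at h
      exact ih p q h.2.2.2

theorem gList_occ (n m : ℕ) : ∀ p q : List AB,
    gList n m = p ++ AB.b :: AB.b :: AB.a :: AB.a :: q → q = [AB.b, AB.a, AB.a, AB.b] := by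
  induction m with
  | zero => exact fList_occ n
  | succ m ih =>
    intro p q h
    obtain ⟨t, ht⟩ := gList_head n m
    rcases p with _ | ⟨x1, _ | ⟨x2, _ | ⟨x3, p⟩⟩⟩
    · simp [gList] at h
    · simp [gList] at h
    · simp [gList, ht] at h
    · simp only [gList, List.cons_append, List.cons.injEq] at h
      exact ih p q h.2.2.2

theorem fList_eq (n : ℕ) : FreeMonoid.ofList (fList n) =
    (wa * wb ^ 2) ^ (n + 1) * (wa ^ 2 * wb) ^ 2 := by
  induction n with
  | zero => rfl
  | succ n ih =>
    rw [pow_succ', mul_assoc, ← ih]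
    rfl

theorem gList_eq (n m : ℕ) : FreeMonoid.ofList (gList n m) =
    (wa ^ 2 * wb) ^ m * (wa * wb ^ 2) ^ (n + 1) * (wa ^ 2 * wb) ^ 2 := by
  induction m with
  | zero => rw [pow_zero, one_mul]; exact fList_eq n
  | succ m ih =>
    rw [pow_succ', mul_assoc, mul_assoc, ← mul_assoc (_ ^ m), ← ih]
    rfl

/-- every word of `L₃` has a unique occurrence of the factor `b²a²`:
any two factorizations `w = p·(b²a²)·q = p'·(b²a²)·q'` coincide. -/
theorem unique_occurrence_b2a2 (w : Word) (hw : w ∈ L3) (p q p' q' : Word)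
    (h : w = p * (wb ^ 2 * wa ^ 2) * q) (h' : w = p' * (wb ^ 2 * wa ^ 2) * q') :
    p = p' ∧ q = q' := by
  obtain ⟨m, n, _, hn, hw⟩ := hw
  obtain ⟨k, rfl⟩ : ∃ k, n = k + 1 := ⟨n - 1, by omega⟩
  rw [← gList_eq] at hw
  have key : ∀ p q : Word, w = p * (wb ^ 2 * wa ^ 2) * q →
      q = FreeMonoid.ofList [AB.b, AB.a, AB.a, AB.b] := by
    intro p q h
    refine gList_occ k m p.toList q.toList ?_
    have h2 : FreeMonoid.ofList (gList k m) = p * ((wb ^ 2 * wa ^ 2) * q) := by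
      rw [← hw, h, mul_assoc]
    exact h2
  have hq : q = q' := (key p q h).trans (key p' q' h').symm
  subst hq
  exact ⟨mul_right_cancel (mul_right_cancel (h.symm.trans h')), rfl⟩
end

section
/- Let L₃ = {(a²b)ᵐ·(ab²)ⁿ·(a²b)² : m ≥ 3, n ≥ 1} over the alphabet {a, b}. Then (a²b)⁴ is syntactically equivalent to (a²b)³ with respect to L₃, and (ab²)² is syntactically equivalent to ab² with respect to L₃. -/
/-- Transition function of a deterministic automaton for `L3`; state `0` is the sink,
`1` is initial, `19` is accepting. -/
def stp : Fin 20 → AB → Fin 20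
  | 1, AB.a => 2
  | 2, AB.a => 3
  | 3, AB.b => 4
  | 4, AB.a => 5
  | 5, AB.a => 6
  | 6, AB.b => 7
  | 7, AB.a => 8
  | 8, AB.a => 9
  | 9, AB.b => 10
  | 10, AB.a => 11
  | 11, AB.a => 9
  | 11, AB.b => 12
  | 12, AB.b => 13
  | 13, AB.a => 14
  | 14, AB.b => 12
  | 14, AB.a => 15
  | 15, AB.b => 16
  | 16, AB.a => 17
  | 17, AB.a => 18
  | 18, AB.b => 19
  | _, _ => 0

/-- Run the automaton on a word. -/
def run (s : Fin 20) (w : Word) : Fin 20 := (FreeMonoid.toList w).foldl stp s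

lemma run_one (s : Fin 20) : run s 1 = s := rfl

lemma run_mul (s : Fin 20) (u v : Word) : run s (u * v) = run (run s u) v := by
  simp [run, FreeMonoid.toList_mul, List.foldl_append]

lemma run_wa (s : Fin 20) : run s wa = stp s AB.a := rfl

lemma run_wb (s : Fin 20) : run s wb = stp s AB.b := rfl

/-- Words that reach a given state. -/
def Reach (s : Fin 20) (w : Word) : Prop :=
  match s with
  | 1 => w = 1
  | 2 => w = wa
  | 3 => w = wa * wa
  | 4 => w = wa ^ 2 * wb
  | 5 => w = (wa ^ 2 * wb) * wa
  | 6 => w = (wa ^ 2 * wb) * wa * wa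
  | 7 => w = (wa ^ 2 * wb) ^ 2
  | 8 => w = (wa ^ 2 * wb) ^ 2 * wa
  | 9 => ∃ m, w = (wa ^ 2 * wb) ^ (m + 2) * wa * wa
  | 10 => ∃ m, w = (wa ^ 2 * wb) ^ (m + 3)
  | 11 => ∃ m, w = (wa ^ 2 * wb) ^ (m + 3) * wa
  | 12 => ∃ m n, w = (wa ^ 2 * wb) ^ (m + 3) * (wa * wb ^ 2) ^ n * wa * wb
  | 13 => ∃ m n, w = (wa ^ 2 * wb) ^ (m + 3) * (wa * wb ^ 2) ^ (n + 1)
  | 14 => ∃ m n, w = (wa ^ 2 * wb) ^ (m + 3) * (wa * wb ^ 2) ^ (n + 1) * wa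
  | 15 => ∃ m n, w = (wa ^ 2 * wb) ^ (m + 3) * (wa * wb ^ 2) ^ (n + 1) * wa * wa
  | 16 => ∃ m n, w = (wa ^ 2 * wb) ^ (m + 3) * (wa * wb ^ 2) ^ (n + 1) * (wa ^ 2 * wb)
  | 17 => ∃ m n, w = (wa ^ 2 * wb) ^ (m + 3) * (wa * wb ^ 2) ^ (n + 1) * (wa ^ 2 * wb) * wa
  | 18 => ∃ m n, w = (wa ^ 2 * wb) ^ (m + 3) * (wa * wb ^ 2) ^ (n + 1) * (wa ^ 2 * wb) * wa * wa
  | 19 => ∃ m n, w = (wa ^ 2 * wb) ^ (m + 3) * (wa * wb ^ 2) ^ (n + 1) * (wa ^ 2 * wb) ^ 2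
  | _ => True

lemma inv_a (s : Fin 20) (w : Word) (h : Reach s w) : Reach (stp s AB.a) (w * wa) := by
  fin_cases s <;> simp only [Reach, stp] at h ⊢
  all_goals first
    | trivial
    | (rw [h]; simp [pow_succ, mul_assoc]; done)
    | exact ⟨0, by rw [h]⟩
    | (obtain ⟨m, rfl⟩ := h; exact ⟨m, rfl⟩)
    | (obtain ⟨m, rfl⟩ := h; exact ⟨m + 1, rfl⟩)
    | (obtain ⟨m, n, rfl⟩ := h; exact ⟨m, n, rfl⟩)

lemma inv_b (s : Fin 20) (w : Word) (h : Reach s w) : Reach (stp s AB.b) (w * wb) := by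
  fin_cases s <;> simp only [Reach, stp] at h ⊢
  all_goals first
    | trivial
    | (rw [h]; simp [pow_succ, mul_assoc]; done)
    | (obtain ⟨m, rfl⟩ := h; refine ⟨m, ?_⟩; simp [pow_succ, mul_assoc]; done)
    | (obtain ⟨m, rfl⟩ := h; refine ⟨m, 0, ?_⟩; simp [pow_succ, mul_assoc]; done)
    | (obtain ⟨m, n, rfl⟩ := h; refine ⟨m, n, ?_⟩; simp [pow_succ, mul_assoc]; done)
    | (obtain ⟨m, n, rfl⟩ := h; refine ⟨m, n + 1, ?_⟩; simp [pow_succ, mul_assoc]; done)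

lemma inv_run (w : Word) : ∀ (s : Fin 20) (u : Word), Reach s u → Reach (run s w) (u * w) := by
  induction w using FreeMonoid.inductionOn' with
  | one => intro s u h; simpa [run_one] using h
  | of_mul x w ih =>
    intro s u h
    rw [run_mul, ← mul_assoc]
    apply ih
    cases x
    · exact inv_a s u h
    · exact inv_b s u h

lemma run_A (m : ℕ) : run 1 ((wa ^ 2 * wb) ^ (m + 3)) = 10 := by
  induction m with
  | zero => simp only [pow_succ, pow_zero, one_mul, run_mul, run_wa, run_wb]; rfl
  | succ m ih =>
    rw [show m + 1 + 3 = (m + 3) + 1 from rfl, pow_succ, run_mul, ih]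
    rfl

lemma run_B (n : ℕ) : run 10 ((wa * wb ^ 2) ^ (n + 1)) = 13 := by
  induction n with
  | zero => simp only [pow_succ, pow_zero, one_mul, run_mul, run_wa, run_wb]; rfl
  | succ n ih =>
    rw [pow_succ, run_mul, ih]
    rfl

lemma mem_L3_iff (w : Word) : w ∈ L3 ↔ run 1 w = 19 := by
  constructor
  · rintro ⟨m, n, hm, hn, rfl⟩
    obtain ⟨m, rfl⟩ := Nat.exists_eq_add_of_le' hm
    obtain ⟨n, rfl⟩ := Nat.exists_eq_add_of_le' hn
    rw [run_mul, run_mul, run_A, run_B]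
    rfl
  · intro h
    have := inv_run w 1 1 rfl
    rw [h, one_mul] at this
    obtain ⟨m, n, e⟩ := this
    exact ⟨m + 3, n + 1, by omega, by omega, e⟩

lemma synEq_of_run (u v : Word) (h : ∀ s, run s u = run s v) : SynEq L3 u v := by
  intro p q
  simp only [mem_L3_iff, run_mul, h]

/-- `(a²b)⁴ ~_{L₃} (a²b)³` and `(ab²)² ~_{L₃} ab²`. -/
theorem synEq_powers_L3 :
    SynEq L3 ((wa ^ 2 * wb) ^ 4) ((wa ^ 2 * wb) ^ 3) ∧
    SynEq L3 ((wa * wb ^ 2) ^ 2) (wa * wb ^ 2) := by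
  constructor
  · apply synEq_of_run
    simp only [pow_succ, pow_zero, one_mul, run_mul, run_wa, run_wb]
    decide
  · apply synEq_of_run
    simp only [pow_succ, pow_zero, one_mul, run_mul, run_wa, run_wb]
    decide
end
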